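/- Fix p ∈ (0,1) and r ≥ 3, and let k ≥ r+1 be the least integer with k!/((k-r)!·k^r) > p. Then H_r(n,p)/E(n,p) ≥ ((k-r+1)!·k^{r-1}/k!)^{n - o(n)}, and the base (k-r+1)!·k^{r-1}/k! is strictly greater than 1. -/

import Mathlib

open Finset

/-- The "r-set" of a permutation `π` of `ZMod n`: the set of `n` edges of the Hamiltonian
cycle of `K_n^r` corresponding to `π`. -/
def rset (n r : ℕ) [NeZero n] (π : Equiv.Perm (ZMod n)) : Finset (Finset (ZMod n)) :=
  Finset.image (fun i : ZMod n =>
    Finset.image (fun j : Fin r => π (i + (j.val : ZMod n))) Finset.univ) Finset.univ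

/-- The set of Hamiltonian cycles of the `r`-graph with edge set `G` on `ZMod n`, each
Hamiltonian cycle identified with its set of `n` edges. -/
def hamCycles (n r : ℕ) [NeZero n] (G : Finset (Finset (ZMod n))) :
    Finset (Finset (Finset (ZMod n))) :=
  Finset.image (rset n r)
    (Finset.univ.filter (fun π : Equiv.Perm (ZMod n) => rset n r π ⊆ G))

/-- `Hmax n r m` : the maximum number of Hamiltonian cycles over all `r`-graphs on `n`
vertices with exactly `m` edges. -/
def Hmax (n r m : ℕ) [NeZero n] : ℕ :=
  Finset.sup (((Finset.univ : Finset (ZMod n)).powersetCard r).powersetCard m)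
    (fun G => (hamCycles n r G).card)

/-- `E n p = p^n (n-1)!/2`, the expected number of Hamiltonian cycles in `G_r(n,p)`. -/
noncomputable def Eexp (n : ℕ) (p : ℝ) : ℝ := p ^ n * (Nat.factorial (n - 1)) / 2

/-- Maclaurin's inequality between an elementary symmetric sum and the mean. -/
theorem sum_powersetCard_prod_le {ι : Type*} [DecidableEq ι] (s : Finset ι) (x : ι → ℝ)
    (hx : ∀ i, 0 ≤ x i) (r : ℕ) :
    ∑ A ∈ s.powersetCard r, ∏ i ∈ A, x i ≤
      (s.card.choose r : ℝ) * ((∑ i ∈ s, x i) / s.card) ^ r := by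
  induction s using Finset.induction_on generalizing r with
  | empty =>
    cases r with
    | zero => simp
    | succ r => simp [powersetCard_eq_empty.2 (show (∅ : Finset ι).card < r + 1 by simp)]
  | insert a s ha ih =>
    cases r with
    | zero => simp
    | succ r =>
      have hdisj : Disjoint (powersetCard (r + 1) s) ((powersetCard r s).image (insert a)) := by
        rw [Finset.disjoint_left]
        intro A hA hA'
        obtain ⟨B, -, rfl⟩ := mem_image.1 hA'
        exact ha ((mem_powersetCard.1 hA).1 (mem_insert_self a B))
      have hinj : Set.InjOn (insert a) (powersetCard r s : Set (Finset ι)) := by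
        intro B hB C hC h
        have hB' : a ∉ B := fun h => ha ((mem_powersetCard.1 hB).1 h)
        have hC' : a ∉ C := fun h => ha ((mem_powersetCard.1 hC).1 h)
        rw [← erase_insert hB', ← erase_insert hC']
        exact congrArg (fun t => t.erase a) h
      rw [powersetCard_succ_insert ha, sum_union hdisj, sum_image hinj]
      have h1 : ∑ A ∈ powersetCard r s, ∏ i ∈ insert a A, x i
          = x a * ∑ A ∈ powersetCard r s, ∏ i ∈ A, x i := by
        rw [mul_sum]
        refine sum_congr rfl fun A hA => prod_insert fun h => ha ((mem_powersetCard.1 hA).1 h)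
      rw [h1, card_insert_of_notMem ha, sum_insert ha]
      set c := s.card
      set m := (∑ i ∈ s, x i) / c with hm
      have hmc : ∑ i ∈ s, x i = c * m := by
        by_cases hc : c = 0
        · have : s = ∅ := card_eq_zero.1 hc
          simp [hc, this]
        · rw [hm, mul_div_cancel₀ _ (Nat.cast_ne_zero.2 hc)]
      have hm0 : 0 ≤ m := div_nonneg (sum_nonneg fun i _ => hx i) (Nat.cast_nonneg _)
      have hc1 : (0 : ℝ) < c + 1 := Nat.cast_add_one_pos c
      have e : (x a + ∑ i ∈ s, x i) / ((c + 1 : ℕ) : ℝ) = m + (x a - m) / (c + 1) := by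
        rw [hmc]; push_cast; rw [div_eq_iff hc1.ne', add_mul, div_mul_cancel₀ _ hc1.ne']; ring
      have hb := pow_add_mul_le_add_pow (b := (x a - m) / (c + 1)) hm0
        (by rw [two_mul, add_assoc, ← e]; exact add_nonneg hm0 <|
            div_nonneg (add_nonneg (hx a) (sum_nonneg fun i _ => hx i))
              (Nat.cast_nonneg _)) (r + 1)
      rw [e]
      have i1 := ih (r + 1)
      have i2 := mul_le_mul_of_nonneg_left (ih r) (hx a)
      refine (add_le_add i1 i2).trans ?_
      refine le_trans (le_of_eq ?_)
        (mul_le_mul_of_nonneg_left hb (Nat.cast_nonneg ((c + 1).choose (r + 1))))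
      have c1 : ((c + 1).choose (r + 1) : ℝ) = c.choose r + c.choose (r + 1) := by
        rw [Nat.choose_succ_succ]; push_cast; rfl
      have c2 : ((c : ℝ) + 1) * c.choose r = (c + 1).choose (r + 1) * (r + 1) := by
        exact_mod_cast Nat.add_one_mul_choose_eq c r
      have c3 : ((c + 1).choose (r + 1) : ℝ) *
          (((r + 1 : ℕ) : ℝ) * m ^ (r + 1 - 1) * ((x a - m) / (c + 1)))
          = c.choose r * (x a - m) * m ^ r := by
        rw [Nat.add_sub_cancel]
        push_cast
        field_simp
        linear_combination (-(m ^ r * (x a - m))) * c2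
      rw [mul_add, c3, c1]
      ring

/-- The `r`-subsets of `V` on which the colouring `c` is injective. -/
def rainbowSets {V ι : Type*} [Fintype V] [DecidableEq V] [DecidableEq ι] (c : V → ι) (r : ℕ) :
    Finset (Finset V) :=
  (univ.powersetCard r).filter fun e => (e.image c).card = r

theorem card_rainbowSets_le {V ι : Type*} [Fintype V] [DecidableEq V] [Fintype ι] [DecidableEq ι]
    (c : V → ι) (r : ℕ) :
    ((rainbowSets c r).card : ℝ) ≤
      ((Fintype.card ι).choose r : ℝ) * (Fintype.card V / Fintype.card ι : ℝ) ^ r := by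
  let fib : ι → Finset V := fun i => univ.filter fun v => c v = i
  have hsub : rainbowSets c r ⊆ (univ.powersetCard r).biUnion fun A =>
      (A.pi fun i => fib i).image fun f => A.attach.image fun i => f i.1 i.2 := by
    intro e he
    rw [rainbowSets, mem_filter, mem_powersetCard] at he
    rw [mem_biUnion]
    refine ⟨e.image c, by simp [he.2], ?_⟩
    have hinj : Set.InjOn c e := card_image_iff.1 (by rw [he.2, he.1.2])
    have hch : ∀ i, ∀ hi : i ∈ e.image c, ∃ v ∈ e, c v = i := fun i hi => mem_image.1 hi
    choose f hf hcf using hch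
    rw [mem_image]
    refine ⟨f, by simp only [mem_pi, fib, mem_filter, mem_univ, true_and]; exact hcf, ?_⟩
    ext v
    simp only [mem_image, mem_attach, true_and, Subtype.exists]
    constructor
    · rintro ⟨i, hi, rfl⟩
      exact hf i (mem_image.2 hi)
    · intro hv
      have hi := mem_image_of_mem c hv
      exact ⟨c v, mem_image.1 hi, hinj (hf _ hi) hv (hcf _ hi)⟩
  have h1 : (rainbowSets c r).card ≤
      ∑ A ∈ (univ : Finset ι).powersetCard r, ∏ i ∈ A, (fib i).card := by
    refine (card_le_card hsub).trans (card_biUnion_le.trans (sum_le_sum fun A _ => ?_))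
    exact card_image_le.trans (card_pi _ _).le
  have h2 := sum_powersetCard_prod_le (univ : Finset ι) (fun i => ((fib i).card : ℝ))
    (fun i => Nat.cast_nonneg _) r
  have h3 : ∑ i, ((fib i).card : ℝ) = Fintype.card V := by
    rw [← Nat.cast_sum, ← card_eq_sum_card_fiberwise (f := c) (t := univ) (s := univ) (by simp)]
    simp
  rw [h3, card_univ] at h2
  refine le_trans ?_ h2
  exact_mod_cast h1

/-- Words of length `n` over `Fin k` in which any `r` consecutive letters are distinct. -/
def distinctWords (k r n : ℕ) : Finset (Fin n → Fin k) :=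
  univ.filter fun w => ∀ i j : Fin n, i < j → j.val < i.val + r → w i ≠ w j

theorem pow_le_card_distinctWords (k r n : ℕ) (hr : 1 ≤ r) (hkr : r ≤ k) :
    (k - r + 1) ^ n ≤ (distinctWords k r n).card := by
  induction n with
  | zero => simp [distinctWords]
  | succ n ih =>
    let bad : (Fin n → Fin k) → Finset (Fin k) := fun w =>
      (univ.filter fun i : Fin n => n < i.val + r).image w
    have hbad : ∀ w, (bad w).card ≤ r - 1 := by
      intro w
      refine card_image_le.trans ?_
      have : ((univ.filter fun i : Fin n => n < i.val + r).image fun i => n - 1 - i.val)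
          ⊆ range (r - 1) := by
        intro x hx
        simp only [mem_image, mem_filter, mem_univ, true_and] at hx
        obtain ⟨i, hi, rfl⟩ := hx
        have := i.2
        rw [mem_range]
        omega
      rw [← card_range (r - 1), ← card_image_of_injOn (f := fun i : Fin n => n - 1 - i.val)]
      · exact card_le_card this
      · intro i _ j _ h
        have := i.2
        have := j.2
        simp only at h
        ext
        omega
    have hcard : ((distinctWords k r n).sigma fun w => univ \ bad w).card
        ≤ (distinctWords k r (n + 1)).card := by
      refine card_le_card_of_injOn (fun p => Fin.snoc (α := fun _ => Fin k) p.1 p.2) ?_ ?_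
      · rintro ⟨w, x⟩ h
        simp only [coe_sigma, Set.mem_sigma_iff, mem_coe, distinctWords, mem_filter, mem_univ,
          true_and, mem_sdiff, bad, mem_image, not_exists, not_and] at h ⊢
        obtain ⟨h1, h2⟩ := h
        intro i j hij hj
        induction j using Fin.lastCases with
        | last =>
          induction i using Fin.lastCases with
          | last => exact absurd hij (lt_irrefl _)
          | cast i =>
            simp only [Fin.snoc_castSucc, Fin.snoc_last]
            exact h2 i (by simpa using hj)
        | cast j =>
          induction i using Fin.lastCases with
          | last => exact absurd hij (not_lt.2 (Fin.le_last _))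
          | cast i =>
            simp only [Fin.snoc_castSucc]
            exact h1 i j (by simpa using hij) (by simpa using hj)
      · rintro ⟨w, x⟩ _ ⟨w', x'⟩ _ h
        obtain ⟨h1, h2⟩ := Fin.snoc_injective2 h
        subst h1 h2
        rfl
    refine le_trans ?_ hcard
    rw [card_sigma, pow_succ]
    refine (Nat.mul_le_mul_right _ ih).trans ?_
    rw [← smul_eq_mul]
    refine card_nsmul_le_sum _ _ _ fun w _ => ?_
    have := hbad w
    rw [card_sdiff_of_subset (subset_univ _), card_univ, Fintype.card_fin]
    omega

theorem exists_subset_card_mul_choose_le {α : Type*} [DecidableEq α] {n m : ℕ} (hnm : n ≤ m)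
    (F : Finset (Finset α)) (T : Finset α) (hF : ∀ H ∈ F, H.card ≤ n) (hT : ∀ H ∈ F, H ⊆ T)
    (hm : m ≤ T.card) :
    ∃ G ⊆ T, G.card = m ∧
      F.card * m.choose n ≤ (F.filter fun H => H ⊆ G).card * T.card.choose n := by
  obtain ⟨e, he⟩ : ∃ e, T.card = e := ⟨_, rfl⟩
  rw [he] at hm ⊢
  induction e, hm using Nat.le_induction generalizing F T with
  | base => exact ⟨T, Subset.rfl, he, by rw [filter_true_of_mem hT]⟩
  | succ e hme ih =>
    have hsum : ∑ x ∈ T, (F.filter fun H => x ∉ H).card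
        = ∑ H ∈ F, (T.filter fun x => x ∉ H).card :=
      sum_card_bipartiteAbove_eq_sum_card_bipartiteBelow fun x H => x ∉ H
    have hlow : F.card * (e + 1 - n) ≤ ∑ x ∈ T, (F.filter fun H => x ∉ H).card := by
      rw [hsum, ← smul_eq_mul]
      refine card_nsmul_le_sum _ _ _ fun H hH => ?_
      rw [filter_notMem_eq_sdiff, card_sdiff_of_subset (hT H hH), he]
      exact Nat.sub_le_sub_left (hF H hH) _
    obtain ⟨x, hx, hxF⟩ : ∃ x ∈ T,
        F.card * (e + 1 - n) ≤ (F.filter fun H => x ∉ H).card * (e + 1) := by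
      by_contra! h
      have hne : T.Nonempty := card_pos.1 (by omega)
      have h2 := sum_lt_sum_of_nonempty hne h
      rw [← sum_mul, sum_const, he, smul_eq_mul] at h2
      have := Nat.mul_le_mul_right (e + 1) hlow
      linarith
    obtain ⟨G, hGT, hGm, hG⟩ := ih (F.filter fun H => x ∉ H) (T.erase x)
      (fun H hH => hF H (mem_filter.1 hH).1)
      (fun H hH => subset_erase.2 ⟨hT H (mem_filter.1 hH).1, (mem_filter.1 hH).2⟩)
      (by rw [card_erase_of_mem hx, he]; rfl)
    refine ⟨G, hGT.trans (erase_subset _ _), hGm, ?_⟩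
    have hle : ((F.filter fun H => x ∉ H).filter fun H => H ⊆ G).card
        ≤ (F.filter fun H => H ⊆ G).card :=
      card_le_card (filter_subset_filter _ (filter_subset _ _))
    refine Nat.le_of_mul_le_mul_right (c := e + 1 - n) ?_ (by omega)
    calc F.card * m.choose n * (e + 1 - n) = F.card * (e + 1 - n) * m.choose n := by ring
      _ ≤ (F.filter fun H => x ∉ H).card * (e + 1) * m.choose n := Nat.mul_le_mul_right _ hxF
      _ = (F.filter fun H => x ∉ H).card * m.choose n * (e + 1) := by ring
      _ ≤ (F.filter fun H => H ⊆ G).card * e.choose n * (e + 1) :=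
          Nat.mul_le_mul_right _ (hG.trans (Nat.mul_le_mul_right _ hle))
      _ = (F.filter fun H => H ⊆ G).card * ((e + 1).choose n * (e + 1 - n)) := by
          rw [← Nat.choose_mul_succ_eq]; ring
      _ = _ := by ring

theorem card_rset_le (n r : ℕ) [NeZero n] (π : Equiv.Perm (ZMod n)) : (rset n r π).card ≤ n :=
  card_image_le.trans (by rw [card_univ, ZMod.card])

theorem mem_rset {n r : ℕ} [NeZero n] {π : Equiv.Perm (ZMod n)} {e : Finset (ZMod n)} :
    e ∈ rset n r π ↔ ∃ i : ZMod n, univ.image (fun j : Fin r => π (i + (j.val : ZMod n))) = e := by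
  simp [rset]

theorem zmod_natCast_inj_of_lt {n a b : ℕ} (ha : a < n) (hb : b < n)
    (h : (a : ZMod n) = b) : a = b := by
  rwa [ZMod.natCast_eq_natCast_iff', Nat.mod_eq_of_lt ha, Nat.mod_eq_of_lt hb] at h

theorem eq_of_rset_eq {n r : ℕ} [NeZero n] (hr : 2 ≤ r) (hn : 2 * r ≤ n)
    {σ τ : Equiv.Perm (ZMod n)} (h : rset n r σ = rset n r τ)
    (hinit : ∀ j < r, σ (j : ZMod n) = τ (j : ZMod n)) : σ = τ := by
  suffices H : ∀ t : ℕ, σ (t : ZMod n) = τ (t : ZMod n) by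
    ext x
    rw [← ZMod.natCast_zmod_val x, H]
  intro t
  induction t using Nat.strong_induction_on with
  | _ t ih =>
  by_cases htr : t < r
  · exact hinit t htr
  obtain ⟨i, rfl⟩ := Nat.exists_eq_add_of_le' (not_lt.1 htr)
  have hmem : univ.image (fun j : Fin r => τ (((i + 1 : ℕ) : ZMod n) + (j.val : ZMod n)))
      ∈ rset n r σ := by
    rw [h]
    exact mem_rset.2 ⟨_, rfl⟩
  obtain ⟨y, hy⟩ := mem_rset.1 hmem
  have hshared : ∀ l, 1 ≤ l → l < r → ∃ u < r, y + (u : ZMod n) = ((i + l : ℕ) : ZMod n) := by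
    intro l hl1 hlr
    have hl : τ ((i + l : ℕ) : ZMod n) ∈
        univ.image (fun j : Fin r => τ (((i + 1 : ℕ) : ZMod n) + (j.val : ZMod n))) := by
      refine mem_image.2 ⟨⟨l - 1, by omega⟩, mem_univ _, ?_⟩
      rw [← Nat.cast_add, show i + 1 + (l - 1) = i + l by omega]
    rw [← hy, ← ih (i + l) (by omega)] at hl
    obtain ⟨u, -, hu⟩ := mem_image.1 hl
    exact ⟨u, u.2, σ.injective hu⟩
  obtain ⟨a, har, ha⟩ := hshared 1 le_rfl (by omega)
  obtain ⟨b, hbr, hb⟩ := hshared (r - 1) (by omega) (by omega)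
  have hab : r - 2 + a = b := by
    refine zmod_natCast_inj_of_lt (n := n) (by omega) (by omega) ?_
    have h1 : ((i + (r - 1) : ℕ) : ZMod n) = ((i + 1 : ℕ) : ZMod n) + ((r - 2 : ℕ) : ZMod n) := by
      rw [← Nat.cast_add]
      congr 1
      omega
    rw [h1, ← ha] at hb
    push_cast
    linear_combination -hb
  have hmemy : ∀ s < r, ∃ j < r, τ ((i + 1 + j : ℕ) : ZMod n) = σ (y + (s : ZMod n)) := by
    intro s hs
    have : σ (y + (s : ZMod n)) ∈ univ.image (fun j : Fin r => σ (y + (j.val : ZMod n))) :=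
      mem_image.2 ⟨⟨s, hs⟩, mem_univ _, rfl⟩
    rw [hy] at this
    obtain ⟨j, -, hj⟩ := mem_image.1 this
    exact ⟨j, j.2, by rw [← hj, Nat.cast_add]⟩
  obtain rfl | rfl : a = 0 ∨ a = 1 := by omega
  · obtain ⟨j, hjr, hj⟩ := hmemy (r - 1) (by omega)
    rw [Nat.cast_zero, add_zero] at ha
    rw [ha, ← Nat.cast_add, show i + 1 + (r - 1) = i + r by omega] at hj
    by_cases hjl : j = r - 1
    · rw [← hj]
      congr 2
      omega
    · rw [← ih (i + 1 + j) (by omega)] at hj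
      have h3 := σ.injective hj
      rw [add_assoc, Nat.cast_add, Nat.cast_add i r] at h3
      have := zmod_natCast_inj_of_lt (n := n) (by omega) (by omega) (add_left_cancel h3)
      omega
  · obtain ⟨j, hjr, hj⟩ := hmemy 0 (by omega)
    have hyi : y = (i : ZMod n) := by
      push_cast at ha
      exact add_right_cancel ha
    rw [hyi, Nat.cast_zero, add_zero, ih i (by omega)] at hj
    have h3 := τ.injective hj
    rw [add_assoc, Nat.cast_add, add_eq_left, ← Nat.cast_zero] at h3
    have := zmod_natCast_inj_of_lt (n := n) (by omega) (by omega) h3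
    omega

theorem card_le_pow_mul_card_image_rset {n r : ℕ} [NeZero n] (hr : 2 ≤ r) (hn : 2 * r ≤ n)
    (P : Finset (Equiv.Perm (ZMod n))) : P.card ≤ n ^ r * (P.image (rset n r)).card := by
  refine card_le_mul_card_image _ _ fun E _ => ?_
  have hcard : (univ : Finset (Fin r → ZMod n)).card = n ^ r := by
    rw [card_univ, Fintype.card_fun, ZMod.card, Fintype.card_fin]
  rw [← hcard]
  refine card_le_card_of_injOn (fun σ j => σ ((j.val : ℕ) : ZMod n)) (by simp) ?_
  intro σ hσ τ hτ h
  have h1 := (mem_filter.1 hσ).2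
  have h2 := (mem_filter.1 hτ).2
  exact eq_of_rset_eq hr hn (h1.trans h2.symm) fun j hj => congrFun h ⟨j, hj⟩

/-- The `r`-sets that contain the apex `z` or are rainbow for `c`. -/
def apexRainbowSets {n k : ℕ} [NeZero n] (r : ℕ) (c : ZMod n → Fin k) (z : ZMod n) :
    Finset (Finset (ZMod n)) :=
  rainbowSets c r ∪ (univ.powersetCard r).filter fun e => z ∈ e

theorem apexRainbowSets_subset {n k : ℕ} [NeZero n] (r : ℕ) (c : ZMod n → Fin k) (z : ZMod n) :
    apexRainbowSets r c z ⊆ univ.powersetCard r :=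
  union_subset (filter_subset _ _) (filter_subset _ _)

theorem card_apexRainbowSets_le {n k r : ℕ} [NeZero n] (c : ZMod n → Fin k)
    (z : ZMod n) :
    ((apexRainbowSets r c z).card : ℝ) ≤
      (k.choose r : ℝ) * ((n : ℝ) / k) ^ r + (n : ℝ) ^ (r - 1) := by
  have h1 := card_rainbowSets_le c r
  rw [ZMod.card, Fintype.card_fin] at h1
  have h2 : ((univ.powersetCard r).filter fun e : Finset (ZMod n) => z ∈ e).card ≤ n ^ (r - 1) := by
    have hsub : ((univ.powersetCard r).filter fun e : Finset (ZMod n) => z ∈ e)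
        ⊆ (univ.powersetCard (r - 1)).image (insert z) := by
      intro e he
      rw [mem_filter, mem_powersetCard] at he
      refine mem_image.2 ⟨e.erase z, ?_, insert_erase he.2⟩
      rw [mem_powersetCard, card_erase_of_mem he.2, he.1.2]
      exact ⟨subset_univ _, rfl⟩
    refine (card_le_card hsub).trans (card_image_le.trans ?_)
    rw [card_powersetCard, card_univ, ZMod.card]
    exact Nat.choose_le_pow _ _
  have h3 : (apexRainbowSets r c z).card ≤ _ := card_union_le _ _
  have h4 : ((apexRainbowSets r c z).card : ℝ) ≤ _ := Nat.cast_le.2 h3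
  push_cast at h4
  have h5 : ((((univ.powersetCard r).filter fun e : Finset (ZMod n) => z ∈ e).card : ℕ) : ℝ)
      ≤ (n : ℝ) ^ (r - 1) := by exact_mod_cast h2
  linarith

theorem rset_subset_apexRainbowSets {n k r : ℕ} [NeZero n] (hrn : r ≤ n)
    (c : ZMod n → Fin k) (π : Equiv.Perm (ZMod n)) (w : Fin n → Fin k)
    (hw : w ∈ distinctWords k r n) (hc : ∀ x, c (π x) = w ⟨x.val, x.val_lt⟩) :
    rset n r π ⊆ apexRainbowSets r c (π 0) := by
  intro e he
  obtain ⟨i, rfl⟩ := mem_rset.1 he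
  have hinj : Function.Injective fun j : Fin r => π (i + (j.val : ZMod n)) := by
    intro a b hab
    have := add_left_cancel (π.injective hab)
    exact Fin.ext (zmod_natCast_inj_of_lt (a.2.trans_le hrn) (b.2.trans_le hrn) this)
  have hcard : (univ.image fun j : Fin r => π (i + (j.val : ZMod n))).card = r := by
    rw [card_image_of_injective _ hinj, card_univ, Fintype.card_fin]
  by_cases hz : π 0 ∈ univ.image fun j : Fin r => π (i + (j.val : ZMod n))
  · exact mem_union_right _
      (mem_filter.2 ⟨mem_powersetCard.2 ⟨subset_univ _, hcard⟩, hz⟩)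
  refine mem_union_left _ (mem_filter.2 ⟨mem_powersetCard.2 ⟨subset_univ _, hcard⟩, ?_⟩)
  have hlt : ∀ j : Fin r, i.val + j.val < n := by
    intro j
    by_contra hj
    have hi := i.val_lt
    refine hz (mem_image.2 ⟨⟨n - i.val, by omega⟩, mem_univ _, ?_⟩)
    have : i + ((n - i.val : ℕ) : ZMod n) = 0 := by
      conv_lhs => rw [← ZMod.natCast_zmod_val i]
      rw [← Nat.cast_add, ZMod.val_natCast_of_lt hi, Nat.add_sub_cancel' hi.le, ZMod.natCast_self]
    rw [this]
  have hval : ∀ j : Fin r, (i + (j.val : ZMod n)).val = i.val + j.val := by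
    intro j
    conv_lhs => rw [← ZMod.natCast_zmod_val i, ← Nat.cast_add]
    exact ZMod.val_natCast_of_lt (hlt j)
  rw [image_image, card_image_of_injective, card_univ, Fintype.card_fin]
  have hw' := (mem_filter.1 hw).2
  have key : ∀ a b : Fin r, a < b → c (π (i + (a.val : ZMod n))) ≠ c (π (i + (b.val : ZMod n))) := by
    intro a b hab
    rw [hc, hc]
    have hab' : a.val < b.val := hab
    refine hw' _ _ ?_ ?_
    · rw [Fin.mk_lt_mk, hval, hval]
      omega
    · simp only [hval]
      omega
  intro a b hab
  rcases lt_trichotomy a b with h | h | h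
  · exact absurd hab (key a b h)
  · exact h
  · exact absurd hab.symm (key b a h)

theorem exists_many_perms {n k r : ℕ} [NeZero n] (hr : 1 ≤ r) (hrk : r ≤ k) (hrn : r ≤ n) :
    ∃ (c : ZMod n → Fin k) (z : ZMod n), n.factorial * (k - r + 1) ^ n ≤
      (univ.filter fun π : Equiv.Perm (ZMod n) => rset n r π ⊆ apexRainbowSets r c z).card
        * (n * k ^ n) := by
  have : NeZero k := ⟨by omega⟩
  have hcount : Fintype.card (Equiv.Perm (ZMod n)) = n.factorial := by
    rw [Fintype.card_perm, ZMod.card]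
  let good : Equiv.Perm (ZMod n) → (ZMod n → Fin k) × ZMod n → Prop := fun π q =>
    rset n r π ⊆ apexRainbowSets r q.1 q.2
  have hπ : ∀ π : Equiv.Perm (ZMod n), (k - r + 1) ^ n ≤ (univ.filter fun q => good π q).card := by
    intro π
    refine (pow_le_card_distinctWords k r n hr hrk).trans ?_
    refine card_le_card_of_injOn
      (fun w => (fun v => w ⟨(π.symm v).val, ZMod.val_lt _⟩, π 0)) ?_ ?_
    · intro w hw
      refine mem_coe.2 (mem_filter.2 ⟨mem_univ _, ?_⟩)
      exact rset_subset_apexRainbowSets hrn _ π w hw fun x => by simp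
    · intro w _ w' _ h
      have h1 := congrArg Prod.fst h
      ext j : 1
      have h2 := congrFun h1 (π (j.val : ZMod n))
      simpa [ZMod.val_natCast_of_lt j.2] using h2
  have hsum : ∑ π : Equiv.Perm (ZMod n), (univ.filter fun q => good π q).card
      = ∑ q, (univ.filter fun π => good π q).card :=
    sum_card_bipartiteAbove_eq_sum_card_bipartiteBelow good
  have hlow : n.factorial * (k - r + 1) ^ n ≤ ∑ q, (univ.filter fun π => good π q).card := by
    rw [← hsum, ← hcount, ← card_univ, ← smul_eq_mul]
    exact card_nsmul_le_sum _ _ _ fun π _ => hπ π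
  have hq : Fintype.card ((ZMod n → Fin k) × ZMod n) = n * k ^ n := by
    rw [Fintype.card_prod, Fintype.card_fun, Fintype.card_fin, ZMod.card, mul_comm]
  by_contra! h
  have h2 := sum_lt_sum_of_nonempty (univ_nonempty (α := (ZMod n → Fin k) × ZMod n))
    fun q _ => h q.1 q.2
  rw [← sum_mul, sum_const, card_univ, hq, smul_eq_mul, mul_comm] at h2
  exact absurd (Nat.lt_of_mul_lt_mul_left h2) (not_lt.2 hlow)

theorem le_Hmax {n r m : ℕ} [NeZero n] {G : Finset (Finset (ZMod n))}
    (hG : G ⊆ univ.powersetCard r) (hm : G.card = m) : (hamCycles n r G).card ≤ Hmax n r m :=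
  le_sup (f := fun G => (hamCycles n r G).card) (mem_powersetCard.2 ⟨hG, hm⟩)

theorem card_hamCycles_mul_pow_le {n r m : ℕ} [NeZero n] (hnm : n ≤ m) (hm : m ≤ n.choose r)
    {T : Finset (Finset (ZMod n))} (hT : T ⊆ univ.powersetCard r) :
    (hamCycles n r T).card * (m + 1 - n) ^ n ≤ Hmax n r m * (max m T.card) ^ n := by
  rcases le_total T.card m with h | h
  · obtain ⟨G, hTG, hG, hGm⟩ := exists_subsuperset_card_eq hT h
      (by rwa [card_powersetCard, card_univ, ZMod.card])
    rw [max_eq_left h]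
    refine Nat.mul_le_mul ?_ (Nat.pow_le_pow_left (by have := NeZero.pos n; omega) n)
    refine le_trans (card_le_card ?_) (le_Hmax hG hGm)
    exact image_subset_image fun π hπ =>
      mem_filter.2 ⟨mem_univ _, (mem_filter.1 hπ).2.trans hTG⟩
  · rw [max_eq_right h]
    have hmem : ∀ H ∈ hamCycles n r T, ∃ π, rset n r π ⊆ T ∧ rset n r π = H := by
      intro H hH
      obtain ⟨π, hπ, rfl⟩ := mem_image.1 hH
      exact ⟨π, (mem_filter.1 hπ).2, rfl⟩
    obtain ⟨G, hGT, hGm, hG⟩ := exists_subset_card_mul_choose_le hnm (hamCycles n r T) T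
      (fun H hH => by obtain ⟨π, -, rfl⟩ := hmem H hH; exact card_rset_le n r π)
      (fun H hH => by obtain ⟨π, hπ, rfl⟩ := hmem H hH; exact hπ) h
    have hle : ((hamCycles n r T).filter fun H => H ⊆ G).card ≤ Hmax n r m := by
      refine le_trans (card_le_card fun H hH => ?_) (le_Hmax (hGT.trans hT) hGm)
      obtain ⟨π, -, rfl⟩ := hmem H (mem_filter.1 hH).1
      exact mem_image_of_mem _ (mem_filter.2 ⟨mem_univ _, (mem_filter.1 hH).2⟩)
    calc (hamCycles n r T).card * (m + 1 - n) ^ n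
        ≤ (hamCycles n r T).card * (n.factorial * m.choose n) := by
          rw [← Nat.descFactorial_eq_factorial_mul_choose]
          exact Nat.mul_le_mul_left _ (Nat.pow_sub_le_descFactorial m n)
      _ = n.factorial * ((hamCycles n r T).card * m.choose n) := by ring
      _ ≤ n.factorial * (Hmax n r m * T.card.choose n) :=
          Nat.mul_le_mul_left _ (hG.trans (Nat.mul_le_mul_right _ hle))
      _ = Hmax n r m * (n.factorial * T.card.choose n) := by ring
      _ ≤ Hmax n r m * T.card ^ n := by
          rw [← Nat.descFactorial_eq_factorial_mul_choose]
          exact Nat.mul_le_mul_left _ (Nat.descFactorial_le_pow _ _)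

theorem eventually_edge_count_bound {r : ℕ} (hr : 2 ≤ r) {p q ρ : ℝ} (hp : 0 < p) (hq : 0 < q)
    (hρ : ρ < 1) :
    ∀ᶠ n : ℕ in Filter.atTop,
      ρ * (p / q) * (q * (n : ℝ) ^ r / r.factorial + (n : ℝ) ^ (r - 1)) ≤ p * n.choose r - n := by
  have hfac : (0 : ℝ) < r.factorial := Nat.cast_pos.2 r.factorial_pos
  have hinv : Filter.Tendsto (fun n : ℕ => ((n : ℝ))⁻¹) Filter.atTop (nhds 0) :=
    tendsto_inv_atTop_nhds_zero_nat
  have hchoose : Filter.Tendsto (fun n : ℕ => (n.choose r : ℝ) / ((n : ℝ) ^ r / r.factorial))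
      Filter.atTop (nhds 1) := by
    refine (Asymptotics.isEquivalent_iff_tendsto_one ?_).1 (isEquivalent_choose r)
    filter_upwards [Filter.eventually_gt_atTop 0] with n hn
    have : (0 : ℝ) < n := Nat.cast_pos.2 hn
    positivity
  have hlim := ((hchoose.const_mul (p / r.factorial)).sub (hinv.pow (r - 1))).sub
    (hinv.const_mul (ρ * (p / q)))
  rw [zero_pow (by omega)] at hlim
  have hlt : ρ * p / r.factorial < p / r.factorial * 1 - 0 - ρ * (p / q) * 0 := by
    rw [mul_one, mul_zero, sub_zero, sub_zero]
    gcongr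
    exact mul_lt_of_lt_one_left hp hρ
  filter_upwards [hlim.eventually_const_lt hlt, Filter.eventually_gt_atTop 0] with n h hn
  have hn0 : (0 : ℝ) < n := Nat.cast_pos.2 hn
  have h2 := mul_le_mul_of_nonneg_right h.le (by positivity : (0 : ℝ) ≤ (n : ℝ) ^ r)
  have e1 : (n : ℝ) ^ r = n * (n : ℝ) ^ (r - 1) := by
    rw [← pow_succ', Nat.sub_add_cancel (by omega)]
  have t1 : p / r.factorial * ((n.choose r : ℝ) / ((n : ℝ) ^ r / r.factorial)) * (n : ℝ) ^ r
      = p * n.choose r := by field_simp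
  have t2 : ((n : ℝ)⁻¹) ^ (r - 1) * (n : ℝ) ^ r = n := by
    rw [e1, inv_pow]; field_simp
  have t3 : ρ * (p / q) * ((n : ℝ)⁻¹) * (n : ℝ) ^ r = ρ * (p / q) * (n : ℝ) ^ (r - 1) := by
    rw [e1]; field_simp
  have t4 : ρ * (p / q) * (q * (n : ℝ) ^ r / r.factorial) = ρ * p / r.factorial * (n : ℝ) ^ r := by
    field_simp
  rw [sub_mul, sub_mul, t1, t2, t3] at h2
  rw [mul_add, t4]
  linarith

theorem one_lt_factorial_mul_pow_div {k r : ℕ} (hr : 3 ≤ r) (hk : r ≤ k) :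
    1 < (Nat.factorial (k - r + 1) : ℝ) * (k : ℝ) ^ (r - 1) / (Nat.factorial k : ℝ) := by
  rw [one_lt_div (Nat.cast_pos.2 k.factorial_pos)]
  have h1 := Nat.factorial_mul_descFactorial (n := k) (k := r - 1) (by omega)
  rw [show k - (r - 1) = k - r + 1 by omega] at h1
  have h2 := Nat.descFactorial_lt_pow (n := k) (by omega) (show 2 ≤ r - 1 by omega)
  rw [← h1]
  exact_mod_cast Nat.mul_lt_mul_of_pos_left h2 (Nat.factorial_pos _)

theorem factorial_ratio_mul {k r : ℕ} (hr : 1 ≤ r) (hk : r ≤ k) :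
    (Nat.factorial (k - r + 1) : ℝ) * (k : ℝ) ^ (r - 1) / (Nat.factorial k : ℝ) *
      ((Nat.factorial k : ℝ) / ((Nat.factorial (k - r) : ℝ) * (k : ℝ) ^ r))
      = ((k - r + 1 : ℕ) : ℝ) / k := by
  have h1 : (Nat.factorial k : ℝ) ≠ 0 := Nat.cast_ne_zero.2 k.factorial_ne_zero
  have h2 : (Nat.factorial (k - r) : ℝ) ≠ 0 := Nat.cast_ne_zero.2 (k - r).factorial_ne_zero
  have h3 : (k : ℝ) ≠ 0 := Nat.cast_ne_zero.2 (by omega)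
  obtain ⟨r, rfl⟩ := Nat.exists_eq_add_of_le' hr
  rw [Nat.factorial_succ (k - (r + 1)), Nat.add_sub_cancel]
  push_cast
  field_simp
  ring

theorem choose_mul_div_pow {k r : ℕ} (hk : r ≤ k) (x : ℝ) :
    (k.choose r : ℝ) * (x / k) ^ r =
      (Nat.factorial k : ℝ) / ((Nat.factorial (k - r) : ℝ) * (k : ℝ) ^ r) * x ^ r
        / r.factorial := by
  rw [Nat.cast_choose ℝ hk, div_pow]
  have h2 : (Nat.factorial (k - r) : ℝ) ≠ 0 := Nat.cast_ne_zero.2 (k - r).factorial_ne_zero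
  have h1 : (Nat.factorial r : ℝ) ≠ 0 := Nat.cast_ne_zero.2 r.factorial_ne_zero
  field_simp

/-- Fix `p ∈ (0,1)` and `r ≥ 3`, and let `k ≥ r+1` be the least integer with
`k!/((k-r)!·k^r) > p`.  Then the base `(k-r+1)!·k^{r-1}/k!` is strictly greater than 1 and
`H_r(n,p)/E(n,p) ≥ ((k-r+1)!·k^{r-1}/k!)^{n-o(n)}`. -/
theorem Hr_exponential_lower_bound (r : ℕ) (hr : 3 ≤ r) (p : ℝ) (hp0 : 0 < p) (hp1 : p < 1)
    (k : ℕ) (hk : r + 1 ≤ k)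
    (hkp : p < (Nat.factorial k : ℝ) / ((Nat.factorial (k - r) : ℝ) * (k : ℝ) ^ r))
    (hkleast : ∀ k' : ℕ, r + 1 ≤ k' → k' < k →
      (Nat.factorial k' : ℝ) / ((Nat.factorial (k' - r) : ℝ) * (k' : ℝ) ^ r) ≤ p) :
    1 < (Nat.factorial (k - r + 1) : ℝ) * (k : ℝ) ^ (r - 1) / (Nat.factorial k : ℝ) ∧
    ∀ ε : ℝ, 0 < ε → ∃ N : ℕ, ∀ (n : ℕ) [NeZero n], N ≤ n →
      ∀ m : ℕ, (m : ℝ) = p * (n.choose r) →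
        (Hmax n r m : ℝ) ≥
          ((Nat.factorial (k - r + 1) : ℝ) * (k : ℝ) ^ (r - 1) / (Nat.factorial k : ℝ)) ^
              ((1 - ε) * (n : ℝ)) * Eexp n p := by
  have hb1 := one_lt_factorial_mul_pow_div hr (by omega : r ≤ k)
  refine ⟨hb1, fun ε hε => ?_⟩
  have hbq := factorial_ratio_mul (by omega : 1 ≤ r) (by omega : r ≤ k)
  have hTq := choose_mul_div_pow (by omega : r ≤ k)
  set b := (Nat.factorial (k - r + 1) : ℝ) * (k : ℝ) ^ (r - 1) / (Nat.factorial k : ℝ)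
  set q := (Nat.factorial k : ℝ) / ((Nat.factorial (k - r) : ℝ) * (k : ℝ) ^ r)
  clear_value b q
  have hb0 : 0 < b := one_pos.trans hb1
  have hq0 : 0 < q := hp0.trans hkp
  have hbε : 1 < b ^ ε := Real.one_lt_rpow hb1 hε
  have hbε0 : 0 < b ^ ε := one_pos.trans hbε
  obtain ⟨β, hβ1, hβ⟩ := exists_between hbε
  have hβ0 : 0 < β := one_pos.trans hβ1
  have hρ : β / b ^ ε < 1 := (div_lt_one hbε0).2 hβ
  have hρ0 : 0 < β / b ^ ε := div_pos hβ0 hbε0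
  obtain ⟨N, hN⟩ := Filter.eventually_atTop.1 <|
    (eventually_edge_count_bound (by omega : 2 ≤ r) hp0 hq0 hρ).and <|
      (((tendsto_pow_const_div_const_pow_of_one_lt r hβ1).eventually_lt_const one_pos)).and
        (Filter.eventually_ge_atTop (2 * r))
  refine ⟨N, fun n _ hn m hm => ?_⟩
  obtain ⟨hedge, hpow, hrn⟩ := hN n hn
  have hn0 : (0 : ℝ) < n := Nat.cast_pos.2 (NeZero.pos n)
  have hk0 : (0 : ℝ) < k := Nat.cast_pos.2 (by omega)
  rw [← hm] at hedge
  have hleft : 0 < β / b ^ ε * (p / q) * (q * (n : ℝ) ^ r / r.factorial + (n : ℝ) ^ (r - 1)) := by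
    positivity
  have hnm : n ≤ m := by
    have : (n : ℝ) ≤ m := by linarith
    exact_mod_cast this
  have hmle : m ≤ n.choose r := by
    have : (m : ℝ) ≤ n.choose r := hm ▸ mul_le_of_le_one_left (Nat.cast_nonneg _) hp1.le
    exact_mod_cast this
  obtain ⟨c, z, hP⟩ := exists_many_perms (n := n) (by omega : 1 ≤ r) (by omega : r ≤ k) (by omega)
  have hfib := card_le_pow_mul_card_image_rset (by omega : 2 ≤ r) hrn
    (univ.filter fun π : Equiv.Perm (ZMod n) => rset n r π ⊆ apexRainbowSets r c z)
  have hH := card_hamCycles_mul_pow_le hnm hmle (apexRainbowSets_subset r c z)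
  have hT := card_apexRainbowSets_le (r := r) c z
  rw [hTq] at hT
  change _ ≤ n ^ r * (hamCycles n r (apexRainbowSets r c z)).card at hfib
  set h := (hamCycles n r (apexRainbowSets r c z)).card
  set M := max m (apexRainbowSets r c z).card with hM
  have hM0 : (0 : ℝ) < M := by
    have : 0 < M := lt_of_lt_of_le ((NeZero.pos n).trans_le hnm) (le_max_left _ _)
    exact_mod_cast this
  have hMle : (M : ℝ) ≤ q * (n : ℝ) ^ r / r.factorial + (n : ℝ) ^ (r - 1) := by
    rw [hM, Nat.cast_max]
    refine max_le ?_ hT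
    have h1 : p * (n.choose r : ℝ) ≤ q * ((n : ℝ) ^ r / r.factorial) :=
      mul_le_mul hkp.le (Nat.choose_le_pow_div r n) (Nat.cast_nonneg _) hq0.le
    rw [hm, mul_div_assoc]
    exact h1.trans (le_add_of_nonneg_right (by positivity))
  have hratio : β / b ^ ε * (p / q) * M ≤ ((m + 1 - n : ℕ) : ℝ) := by
    rw [Nat.cast_sub (by omega)]
    push_cast
    have := mul_le_mul_of_nonneg_left hMle (by positivity : 0 ≤ β / b ^ ε * (p / q))
    linarith
  have hHr : (h : ℝ) * (β / b ^ ε * (p / q)) ^ n ≤ Hmax n r m := by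
    refine le_of_mul_le_mul_right ?_ (pow_pos hM0 n)
    calc (h : ℝ) * (β / b ^ ε * (p / q)) ^ n * (M : ℝ) ^ n
        = h * (β / b ^ ε * (p / q) * M) ^ n := by rw [mul_pow _ (M : ℝ)]; ring
      _ ≤ h * ((m + 1 - n : ℕ) : ℝ) ^ n := by gcongr
      _ ≤ _ := by exact_mod_cast hH
  have hh : ((n - 1).factorial : ℝ) * (b * q) ^ n ≤ n ^ r * h := by
    have h1 : n.factorial * (k - r + 1) ^ n ≤ n ^ r * h * (n * k ^ n) :=
      hP.trans (Nat.mul_le_mul_right _ hfib)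
    rw [← Nat.mul_factorial_pred (NeZero.ne n)] at h1
    have h2 : ((n : ℝ) * (n - 1).factorial) * ((k - r + 1 : ℕ) : ℝ) ^ n
        ≤ n ^ r * h * (n * k ^ n) := by exact_mod_cast h1
    rw [hbq, div_pow, ← mul_div_assoc, div_le_iff₀ (by positivity)]
    refine le_of_mul_le_mul_left ?_ hn0
    linarith
  have hexp : b ^ ((1 - ε) * (n : ℝ)) = (b / b ^ ε) ^ n := by
    rw [Real.rpow_mul hb0.le, Real.rpow_natCast, Real.rpow_sub hb0, Real.rpow_one]
  have hpow' : (n : ℝ) ^ r ≤ β ^ n := by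
    rw [div_lt_one (by positivity)] at hpow
    exact hpow.le
  rw [ge_iff_le, hexp, Eexp]
  refine le_trans ?_ hHr
  refine le_of_mul_le_mul_left ?_ (by positivity : (0 : ℝ) < (n : ℝ) ^ r)
  calc (n : ℝ) ^ r * ((b / b ^ ε) ^ n * (p ^ n * (n - 1).factorial / 2))
      ≤ β ^ n * ((b / b ^ ε) ^ n * (p ^ n * (n - 1).factorial / 1)) := by
        gcongr
        norm_num
    _ = (n - 1).factorial * (b * q) ^ n * (β / b ^ ε * (p / q)) ^ n := by
        rw [div_one, mul_assoc _ _ ((β / b ^ ε * (p / q)) ^ n), ← mul_pow,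
          show b * q * (β / b ^ ε * (p / q)) = β * (b / b ^ ε) * p by field_simp, mul_pow, mul_pow]
        ring
    _ ≤ n ^ r * h * (β / b ^ ε * (p / q)) ^ n := by gcongr
    _ = _ := by ring
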